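/- Fix an integer k ≥ 1. For u : ℤ^d → ℝ define Δu(n) := Σ_{j=1}^{d} (2u(n) − u(n − e_j) − u(n + e_j)), where e_j is the j-th standard basis vector, and let |n| denote the Euclidean norm of n. Then there exist positive constants c₁, c₂ and a natural number N, independent of d, such that for every d ≥ N: (i) for every finitely supported u : ℤ^d → ℝ with u(0) = 0, Σ_{n∈ℤ^d} |Δ^k u(n)|² ≥ c₁ d^{2k} Σ_{n∈ℤ^d, n≠0} |u(n)|²/|n|^{4k}; and (ii) there exists a finitely supported u : ℤ^d → ℝ with u(0) = 0, not identically zero, such that Σ_{n∈ℤ^d} |Δ^k u(n)|² ≤ c₂ d^{2k} Σ_{n∈ℤ^d, n≠0} |u(n)|²/|n|^{4k}. In other words, the sharp constant C₂(k,d) in the discrete higher-order Rellich inequality on ℤ^d grows like d^{2k} as d → ∞. -/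

import Mathlib

/-- The discrete Laplacian on the lattice `ℤ^d`:
`Δu(n) = Σ_j (2u(n) − u(n − e_j) − u(n + e_j))`. -/
def latticeDelta (d : ℕ) (u : (Fin d → ℤ) → ℝ) (n : Fin d → ℤ) : ℝ :=
  ∑ j : Fin d, (2 * u n - u (n - Pi.single j 1) - u (n + Pi.single j 1))

section Weights

lemma exists_inv_pow_le_quadratic (m : ℕ) :
    ∃ C : ℝ, 0 ≤ C ∧ ∀ t : ℝ, 1 / 4 ≤ t → t⁻¹ ^ m ≤ 1 - m * (t - 1) + C * (t - 1) ^ 2 := by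
  induction m with
  | zero => exact ⟨0, le_rfl, fun t _ => by simp⟩
  | succ m ih =>
    obtain ⟨C, hC, h⟩ := ih
    refine ⟨4 * (m + 1 + C), by positivity, fun t ht => ?_⟩
    have ht0 : 0 < t := by linarith
    have hinv : t⁻¹ ≤ 4 := by
      rw [inv_le_comm₀ ht0 (by norm_num)]; linarith
    calc t⁻¹ ^ (m + 1) = t⁻¹ ^ m * t⁻¹ := pow_succ _ _
      _ ≤ (1 - m * (t - 1) + C * (t - 1) ^ 2) * t⁻¹ := by gcongr; exact h t ht
      _ = 1 - (m + 1) * (t - 1) + t⁻¹ * ((m + 1 + C) * (t - 1) ^ 2) := by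
        field_simp; ring
      _ ≤ 1 - (m + 1) * (t - 1) + 4 * ((m + 1 + C) * (t - 1) ^ 2) := by gcongr
      _ = 1 - ((m + 1 : ℕ) : ℝ) * (t - 1) + 4 * (m + 1 + C) * (t - 1) ^ 2 := by
        push_cast; ring

lemma exists_inv_pow_symm_add_le (m : ℕ) :
    ∃ C : ℝ, 0 ≤ C ∧ ∀ y x : ℝ, 2 + x ^ 2 ≤ y →
      (y + 2 * x)⁻¹ ^ m + (y - 2 * x)⁻¹ ^ m ≤ y⁻¹ ^ m * (2 + C * (x ^ 2 / y ^ 2)) := by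
  obtain ⟨C, hC, h⟩ := exists_inv_pow_le_quadratic m
  refine ⟨8 * C, by positivity, fun y x hyx => ?_⟩
  have hy : 0 < y := by nlinarith [sq_nonneg x]
  have key : ∀ z : ℝ, z ^ 2 = x ^ 2 →
      (y + 2 * z)⁻¹ ^ m ≤ y⁻¹ ^ m * (1 - m * (2 * z / y) + C * (2 * z / y) ^ 2) := by
    intro z hz
    have e : y + 2 * z = y * (1 + 2 * z / y) := by field_simp
    have ht : 1 / 4 ≤ 1 + 2 * z / y := by
      have : -(3 / 4) ≤ 2 * z / y := by
        rw [le_div_iff₀ hy]; nlinarith [sq_nonneg (3 * z + 4)]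
      linarith
    rw [e, mul_inv, mul_pow]
    gcongr
    simpa using h _ ht
  have h1 := key x rfl
  have h2 := key (-x) (neg_sq x)
  have e2 : y + 2 * -x = y - 2 * x := by ring
  rw [e2] at h2
  calc _ ≤ _ := add_le_add h1 h2
    _ = _ := by field_simp; ring

/-- The weight `1 + |n|²` on the lattice. -/
def latticeWeight {d : ℕ} (n : Fin d → ℤ) : ℝ := 1 + ∑ j, (n j : ℝ) ^ 2

variable {d : ℕ}

lemma one_le_latticeWeight (n : Fin d → ℤ) : 1 ≤ latticeWeight n := by
  have : 0 ≤ ∑ j, (n j : ℝ) ^ 2 := by positivity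
  unfold latticeWeight; linarith

lemma latticeWeight_add_single (n : Fin d → ℤ) (j : Fin d) (a : ℤ) :
    latticeWeight (n + Pi.single j a) = latticeWeight n + 2 * a * n j + a ^ 2 := by
  have : ∀ i, (((n + Pi.single j a : Fin d → ℤ) i : ℤ) : ℝ) ^ 2
      = (n i : ℝ) ^ 2 + if i = j then 2 * a * (n j : ℝ) + a ^ 2 else 0 := by
    intro i
    by_cases h : i = j
    · subst h; simp; ring
    · simp [h]
  simp only [latticeWeight, this, Finset.sum_add_distrib]
  simp; ring

lemma exists_weight_le_latticeDelta_weight (m : ℕ) (hm : 1 ≤ m) :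
    ∃ N : ℕ, ∀ d : ℕ, N ≤ d → ∀ n : Fin d → ℤ,
      d * (1 / 2) ^ m * (latticeWeight n)⁻¹ ^ (m + 1) ≤
        latticeDelta d (fun n => (latticeWeight n)⁻¹ ^ m) n := by
  obtain ⟨C, hC, h⟩ := exists_inv_pow_symm_add_le m
  refine ⟨⌈C⌉₊, fun d hd n => ?_⟩
  have hdC : C ≤ d := (Nat.le_ceil C).trans (by exact_mod_cast hd)
  set S := latticeWeight n with hS
  have hS1 : 1 ≤ S := one_le_latticeWeight n
  have hsum : ∑ j, (n j : ℝ) ^ 2 = S - 1 := by simp [hS, latticeWeight]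
  set Y := (S + 1)⁻¹ ^ m with hY
  have hY0 : 0 < Y := by positivity
  have hterm : ∀ j : Fin d,
      2 * S⁻¹ ^ m - Y * (2 + C * ((n j : ℝ) ^ 2 / (S + 1) ^ 2)) ≤
        2 * S⁻¹ ^ m - (latticeWeight (n - Pi.single j 1))⁻¹ ^ m -
          (latticeWeight (n + Pi.single j 1))⁻¹ ^ m := by
    intro j
    have hj : (n j : ℝ) ^ 2 ≤ S - 1 := by
      rw [← hsum]
      exact Finset.single_le_sum (f := fun j => (n j : ℝ) ^ 2) (fun i _ => sq_nonneg _)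
        (Finset.mem_univ j)
    have := h (S + 1) (n j) (by linarith)
    have e1 : latticeWeight (n + Pi.single j 1) = S + 1 + 2 * n j := by
      rw [latticeWeight_add_single]; push_cast; ring
    have e2 : latticeWeight (n - Pi.single j 1) = S + 1 - 2 * n j := by
      rw [sub_eq_add_neg, ← Pi.single_neg, latticeWeight_add_single]; push_cast; ring
    rw [e1, e2]
    linarith
  have hbern : Y * (1 + 1 / S) ≤ S⁻¹ ^ m := by
    have h1 : 1 + 1 / S ≤ (1 + 1 / S) ^ m :=
      le_self_pow₀ (by have : 0 ≤ 1 / S := by positivity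
                       linarith) (by omega)
    calc Y * (1 + 1 / S) ≤ Y * (1 + 1 / S) ^ m := by gcongr
      _ = S⁻¹ ^ m := by
        rw [hY, ← mul_pow]; congr 1; field_simp
  have hfrac : (S - 1) / (S + 1) ^ 2 ≤ 1 / S := by
    rw [div_le_div_iff₀ (by positivity) (by positivity)]; nlinarith
  have hhalf : (1 / 2) ^ m * S⁻¹ ^ m ≤ Y := by
    rw [hY, ← mul_pow]
    gcongr
    rw [one_div, ← mul_inv]
    gcongr
    linarith
  calc d * (1 / 2) ^ m * S⁻¹ ^ (m + 1)
      = d * ((1 / 2) ^ m * S⁻¹ ^ m) * (1 / S) := by rw [pow_succ, one_div S]; ring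
    _ ≤ d * Y * (1 / S) := by gcongr
    _ = 2 * d * (Y * (1 + 1 / S) - Y) - Y * (d * (1 / S)) := by ring
    _ ≤ 2 * d * (S⁻¹ ^ m - Y) - Y * (C * ((S - 1) / (S + 1) ^ 2)) := by gcongr
    _ = ∑ j : Fin d, (2 * S⁻¹ ^ m - Y * (2 + C * ((n j : ℝ) ^ 2 / (S + 1) ^ 2))) := by
      simp only [mul_add, Finset.sum_sub_distrib, Finset.sum_add_distrib, ← Finset.mul_sum,
        ← Finset.sum_div, hsum]
      simp; ring
    _ ≤ _ := Finset.sum_le_sum fun j _ => hterm j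

end Weights

section Laplacian

variable {d : ℕ}

lemma finite_support_comp_add {f : (Fin d → ℤ) → ℝ} (hf : f.support.Finite) (a : Fin d → ℤ) :
    (Function.support fun n => f (n + a)).Finite :=
  hf.preimage (add_left_injective a).injOn

lemma finite_support_comp_sub {f : (Fin d → ℤ) → ℝ} (hf : f.support.Finite) (a : Fin d → ℤ) :
    (Function.support fun n => f (n - a)).Finite :=
  hf.preimage sub_left_injective.injOn

lemma finite_support_latticeDelta {u : (Fin d → ℤ) → ℝ} (hu : u.support.Finite) :
    (latticeDelta d u).support.Finite := by
  refine ((hu.union (Set.finite_iUnion fun j : Fin d =>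
    (finite_support_comp_sub hu (Pi.single j 1)).union
      (finite_support_comp_add hu (Pi.single j 1))))).subset fun n hn => ?_
  by_contra hcon
  simp only [Set.mem_union, Set.mem_iUnion, Function.mem_support, not_or, not_exists,
    not_not] at hcon
  apply hn
  simp [latticeDelta, hcon.1, fun j => (hcon.2 j).1, fun j => (hcon.2 j).2]

lemma finite_support_iterate_latticeDelta {u : (Fin d → ℤ) → ℝ} (hu : u.support.Finite)
    (k : ℕ) : ((latticeDelta d)^[k] u).support.Finite := by
  induction k with
  | zero => simpa
  | succ k ih => rw [Function.iterate_succ_apply']; exact finite_support_latticeDelta ih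

lemma summable_mul_of_finite_support {f : (Fin d → ℤ) → ℝ} (hf : f.support.Finite)
    (g : (Fin d → ℤ) → ℝ) : Summable fun n => f n * g n :=
  summable_of_hasFiniteSupport (hf.subset (Function.support_mul_subset_left f g))

lemma summable_sq_mul_of_finite_support {f : (Fin d → ℤ) → ℝ} (hf : f.support.Finite)
    (g : (Fin d → ℤ) → ℝ) : Summable fun n => f n ^ 2 * g n := by
  simpa only [sq, mul_assoc] using summable_mul_of_finite_support hf fun n => f n * g n

lemma tsum_latticeDelta_mul {g : (Fin d → ℤ) → ℝ} (hg : g.support.Finite)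
    (v : (Fin d → ℤ) → ℝ) :
    ∑' n, latticeDelta d g n * v n = ∑' n, g n * latticeDelta d v n := by
  have hs := summable_mul_of_finite_support hg
  have hs1 := fun j : Fin d => summable_mul_of_finite_support
    (finite_support_comp_sub hg (Pi.single j 1)) v
  have hs2 := fun j : Fin d => summable_mul_of_finite_support
    (finite_support_comp_add hg (Pi.single j 1)) v
  simp only [latticeDelta, Finset.sum_mul, Finset.mul_sum, sub_mul, mul_sub]
  rw [Summable.tsum_finsetSum, Summable.tsum_finsetSum]
  · refine Finset.sum_congr rfl fun j _ => ?_
    have h2 : Summable fun n => 2 * g n * v n := by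
      simpa only [mul_assoc] using (hs v).mul_left 2
    have h2' : Summable fun n => g n * (2 * v n) := hs _
    rw [(h2.sub (hs1 j)).tsum_sub (hs2 j), h2.tsum_sub (hs1 j),
      (h2'.sub (hs _)).tsum_sub (hs _), h2'.tsum_sub (hs _)]
    have e1 : ∑' n, g (n - Pi.single j 1) * v n = ∑' n, g n * v (n + Pi.single j 1) := by
      refine ((Equiv.addRight (Pi.single j 1 : Fin d → ℤ)).tsum_eq
        fun n => g (n - Pi.single j 1) * v n).symm.trans ?_
      simp
    have e2 : ∑' n, g (n + Pi.single j 1) * v n = ∑' n, g n * v (n - Pi.single j 1) := by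
      refine ((Equiv.subRight (Pi.single j 1 : Fin d → ℤ)).tsum_eq
        fun n => g (n + Pi.single j 1) * v n).symm.trans ?_
      simp
    have e3 : ∑' n, 2 * g n * v n = ∑' n, g n * (2 * v n) :=
      tsum_congr fun n => by ring
    rw [e1, e2, e3]; ring
  · exact fun j _ => ((hs _).sub (hs _)).sub (hs _)
  · refine fun j _ => Summable.sub (Summable.sub ?_ (hs1 j)) (hs2 j)
    simpa only [mul_assoc] using (hs v).mul_left 2

lemma latticeDelta_sq_le (u : (Fin d → ℤ) → ℝ) (n : Fin d → ℤ) :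
    latticeDelta d (fun n => u n ^ 2) n ≤ 2 * (u n * latticeDelta d u n) := by
  simp only [latticeDelta, Finset.mul_sum]
  refine Finset.sum_le_sum fun j _ => ?_
  nlinarith [sq_nonneg (u n - u (n - Pi.single j 1)), sq_nonneg (u n - u (n + Pi.single j 1))]

lemma finite_support_sq {u : (Fin d → ℤ) → ℝ} (hu : u.support.Finite) :
    (Function.support fun n => u n ^ 2).Finite := by
  simpa [Function.support_pow'] using hu

lemma exists_weighted_rellich_step (j : ℕ) :
    ∃ c : ℝ, 0 < c ∧ ∃ N : ℕ, ∀ d : ℕ, N ≤ d → ∀ u : (Fin d → ℤ) → ℝ, u.support.Finite →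
      c * d ^ 2 * ∑' n, u n ^ 2 * (latticeWeight n)⁻¹ ^ (2 * (j + 1)) ≤
        ∑' n, latticeDelta d u n ^ 2 * (latticeWeight n)⁻¹ ^ (2 * j) := by
  obtain ⟨N, hN⟩ := exists_weight_le_latticeDelta_weight (2 * j + 1) (by omega)
  set b : ℝ := (1 / 2) ^ (2 * j + 1) / 2 with hb
  have hb0 : 0 < b := by positivity
  refine ⟨b ^ 2, by positivity, N, fun d hd u hu => ?_⟩
  have hL : 0 ≤ b * d := by positivity
  set v : (Fin d → ℤ) → ℝ := fun n => (latticeWeight n)⁻¹ ^ (2 * j + 1) with hv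
  set B := ∑' n, u n ^ 2 * (latticeWeight n)⁻¹ ^ (2 * (j + 1)) with hB
  set A := ∑' n, latticeDelta d u n ^ 2 * (latticeWeight n)⁻¹ ^ (2 * j) with hA
  have hDu := finite_support_latticeDelta hu
  have hsA := summable_sq_mul_of_finite_support hDu fun n => (latticeWeight n)⁻¹ ^ (2 * j)
  have hsB := summable_sq_mul_of_finite_support hu fun n => (latticeWeight n)⁻¹ ^ (2 * (j + 1))
  have lower : 2 * (b * d) * B ≤ ∑' n, latticeDelta d (fun n => u n ^ 2) n * v n := by
    rw [tsum_latticeDelta_mul (finite_support_sq hu), hB, ← tsum_mul_left]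
    refine (hsB.mul_left _).tsum_le_tsum (fun n => ?_) (summable_sq_mul_of_finite_support hu _)
    have := mul_le_mul_of_nonneg_left (hN d hd n) (sq_nonneg (u n))
    refine le_trans (le_of_eq ?_) this
    rw [hb]; ring
  have upper : (b * d) * ∑' n, latticeDelta d (fun n => u n ^ 2) n * v n ≤
      A + (b * d) ^ 2 * B := by
    rw [hA, hB, ← tsum_mul_left, ← tsum_mul_left, ← hsA.tsum_add (hsB.mul_left _)]
    refine ((summable_mul_of_finite_support
      (finite_support_latticeDelta (finite_support_sq hu)) v).mul_left _).tsum_le_tsum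
      (fun n => ?_) (hsA.add (hsB.mul_left _))
    have hw : 0 ≤ (latticeWeight n)⁻¹ := by
      have := one_le_latticeWeight n; positivity
    have h1 : latticeDelta d (fun n => u n ^ 2) n * v n ≤
        2 * (u n * latticeDelta d u n) * v n := by
      have : 0 ≤ v n := pow_nonneg hw _
      gcongr
      exact latticeDelta_sq_le u n
    refine (mul_le_mul_of_nonneg_left h1 hL).trans ?_
    have := sq_nonneg (latticeDelta d u n * (latticeWeight n)⁻¹ ^ j -
      b * d * (u n * (latticeWeight n)⁻¹ ^ (j + 1)))
    simp only [hv]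
    refine sub_nonneg.1 (this.trans (le_of_eq ?_))
    ring
  have := (mul_le_mul_of_nonneg_left lower hL).trans upper
  nlinarith

lemma exists_weighted_rellich (k : ℕ) :
    ∃ c : ℝ, 0 < c ∧ ∃ N : ℕ, ∀ d : ℕ, N ≤ d → ∀ u : (Fin d → ℤ) → ℝ, u.support.Finite →
      c * d ^ (2 * k) * ∑' n, u n ^ 2 * (latticeWeight n)⁻¹ ^ (2 * k) ≤
        ∑' n, ((latticeDelta d)^[k] u) n ^ 2 := by
  induction k with
  | zero => exact ⟨1, one_pos, 0, fun d _ u _ => by simp⟩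
  | succ k ih =>
    obtain ⟨c, hc, N, h⟩ := ih
    obtain ⟨c', hc', N', h'⟩ := exists_weighted_rellich_step k
    refine ⟨c * c', by positivity, max N N', fun d hd u hu => ?_⟩
    rw [Function.iterate_succ_apply]
    refine le_trans ?_ (h d (le_of_max_le_left hd) _ (finite_support_latticeDelta hu))
    refine le_trans (le_of_eq ?_)
      (mul_le_mul_of_nonneg_left (h' d (le_of_max_le_right hd) u hu) (by positivity))
    ring

lemma tsum_latticeDelta_sq_le {u : (Fin d → ℤ) → ℝ} (hu : u.support.Finite) :
    ∑' n, latticeDelta d u n ^ 2 ≤ 16 * d ^ 2 * ∑' n, u n ^ 2 := by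
  have hs : ∀ {f : (Fin d → ℤ) → ℝ}, f.support.Finite → Summable fun n => f n ^ 2 :=
    fun hf => summable_of_hasFiniteSupport (finite_support_sq hf)
  have hs1 := fun j : Fin d => hs (finite_support_comp_sub hu (Pi.single j 1))
  have hs2 := fun j : Fin d => hs (finite_support_comp_add hu (Pi.single j 1))
  have hs3 := fun j : Fin d =>
    ((((hs hu).mul_left 2).add (hs1 j)).add (hs2 j)).mul_left (4 * (d : ℝ))
  calc ∑' n, latticeDelta d u n ^ 2
      ≤ ∑' n, ∑ j : Fin d, 4 * (d : ℝ) * (2 * u n ^ 2 + u (n - Pi.single j 1) ^ 2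
          + u (n + Pi.single j 1) ^ 2) := by
        refine (hs (finite_support_latticeDelta hu)).tsum_le_tsum (fun n => ?_)
          (summable_sum fun j _ => hs3 j)
        refine (sq_sum_le_card_mul_sum_sq (s := Finset.univ)).trans ?_
        rw [Finset.mul_sum]
        refine Finset.sum_le_sum fun j _ => ?_
        rw [Finset.card_univ, Fintype.card_fin, mul_comm 4 (d : ℝ), mul_assoc]
        gcongr
        nlinarith [sq_nonneg (u n + u (n - Pi.single j 1)),
          sq_nonneg (u n + u (n + Pi.single j 1)),
          sq_nonneg (u (n - Pi.single j 1) - u (n + Pi.single j 1))]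
    _ = ∑ j : Fin d, 16 * (d : ℝ) * ∑' n, u n ^ 2 := by
        rw [Summable.tsum_finsetSum fun j _ => hs3 j]
        refine Finset.sum_congr rfl fun j _ => ?_
        rw [tsum_mul_left, (((hs hu).mul_left 2).add (hs1 j)).tsum_add (hs2 j),
          ((hs hu).mul_left 2).tsum_add (hs1 j), tsum_mul_left,
          show ∑' n : Fin d → ℤ, u (n - Pi.single j 1) ^ 2 = ∑' n, u n ^ 2 from
            (Equiv.subRight (Pi.single j 1 : Fin d → ℤ)).tsum_eq fun n => u n ^ 2,
          show ∑' n : Fin d → ℤ, u (n + Pi.single j 1) ^ 2 = ∑' n, u n ^ 2 from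
            (Equiv.addRight (Pi.single j 1 : Fin d → ℤ)).tsum_eq fun n => u n ^ 2]
        ring
    _ = 16 * d ^ 2 * ∑' n, u n ^ 2 := by simp; ring

lemma tsum_iterate_latticeDelta_sq_le {u : (Fin d → ℤ) → ℝ} (hu : u.support.Finite) (k : ℕ) :
    ∑' n, ((latticeDelta d)^[k] u) n ^ 2 ≤ 16 ^ k * d ^ (2 * k) * ∑' n, u n ^ 2 := by
  induction k with
  | zero => simp
  | succ k ih =>
    rw [Function.iterate_succ_apply']
    refine (tsum_latticeDelta_sq_le (finite_support_iterate_latticeDelta hu k)).trans ?_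
    refine (mul_le_mul_of_nonneg_left ih (by positivity)).trans (le_of_eq ?_)
    ring

lemma one_le_sum_sq_of_ne_zero {n : Fin d → ℤ} (hn : n ≠ 0) : 1 ≤ ∑ j, (n j : ℝ) ^ 2 := by
  obtain ⟨j, hj⟩ := Function.ne_iff.1 hn
  have h1 : (1 : ℝ) ≤ (n j : ℝ) ^ 2 := by
    exact_mod_cast Int.add_one_le_iff.2 (sq_pos_of_ne_zero (by simpa using hj))
  exact h1.trans (Finset.single_le_sum (f := fun j => (n j : ℝ) ^ 2) (fun i _ => sq_nonneg _)
        (Finset.mem_univ j))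

lemma tsum_sq_div_le_tsum_weight {u : (Fin d → ℤ) → ℝ} (hu : u.support.Finite) (k : ℕ) :
    ∑' n : {m : Fin d → ℤ // m ≠ 0}, u n.1 ^ 2 / (∑ j, (n.1 j : ℝ) ^ 2) ^ k ≤
      2 ^ k * ∑' n, u n ^ 2 * (latticeWeight n)⁻¹ ^ k := by
  have hs := (summable_sq_mul_of_finite_support hu fun n => (latticeWeight n)⁻¹ ^ k).mul_left
    ((2 : ℝ) ^ k)
  have hw : ∀ n : Fin d → ℤ, 0 < latticeWeight n := fun n =>
    one_pos.trans_le (one_le_latticeWeight n)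
  rw [← tsum_mul_left]
  refine (Summable.tsum_le_tsum (fun n => ?_) (summable_of_hasFiniteSupport ?_)
    (hs.subtype {m | m ≠ 0})).trans
    (hs.tsum_subtype_le _ {m | m ≠ 0} fun n => ?_)
  · have h1 := one_le_sum_sq_of_ne_zero n.2
    have h2 := hw n.1
    simp only [Function.comp_apply]
    rw [mul_left_comm, ← mul_pow, div_eq_mul_inv, ← inv_pow]
    gcongr
    rw [← div_eq_mul_inv, le_div_iff₀ h2, inv_mul_le_iff₀ (by linarith), latticeWeight]
    linarith
  · refine (hu.preimage Subtype.val_injective.injOn).subset fun n hn h0 => hn ?_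
    simp [h0]
  · have := hw n
    positivity

end Laplacian

/-- The sharp constant `C₂(k,d)` in the discrete higher-order Rellich inequality
`Σ |Δ^k u|² ≥ C₂(k,d) Σ |u(n)|²/|n|^{4k}` on `ℤ^d` grows like `d^{2k}`
as `d → ∞`. -/
theorem discrete_rellich_sharp_constant_asymptotics (k : ℕ) (hk : 1 ≤ k) :
    ∃ c₁ c₂ : ℝ, ∃ N : ℕ, 0 < c₁ ∧ 0 < c₂ ∧
      ∀ d : ℕ, N ≤ d →
        (∀ u : (Fin d → ℤ) → ℝ, (Function.support u).Finite → u 0 = 0 →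
          c₁ * (d : ℝ) ^ (2 * k) *
              ∑' n : {m : Fin d → ℤ // m ≠ 0},
                |u n.1| ^ 2 / (∑ j : Fin d, ((n.1 j : ℝ)) ^ 2) ^ (2 * k) ≤
            ∑' n : Fin d → ℤ, |((latticeDelta d)^[k] u) n| ^ 2) ∧
        ∃ u : (Fin d → ℤ) → ℝ, (Function.support u).Finite ∧ u 0 = 0 ∧ u ≠ 0 ∧
          ∑' n : Fin d → ℤ, |((latticeDelta d)^[k] u) n| ^ 2 ≤
            c₂ * (d : ℝ) ^ (2 * k) *
              ∑' n : {m : Fin d → ℤ // m ≠ 0},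
                |u n.1| ^ 2 / (∑ j : Fin d, ((n.1 j : ℝ)) ^ 2) ^ (2 * k) := by
  obtain ⟨c, hc, N, h⟩ := exists_weighted_rellich k
  refine ⟨c / 2 ^ (2 * k), 16 ^ k, max N 1, by positivity, by positivity, fun d hd => ⟨?_, ?_⟩⟩
  · intro u hu _
    simp only [sq_abs]
    refine le_trans ?_ (h d (le_of_max_le_left hd) u hu)
    refine (mul_le_mul_of_nonneg_left (tsum_sq_div_le_tsum_weight hu (2 * k))
      (by positivity)).trans (le_of_eq ?_)
    field_simp
  · set e : Fin d → ℤ := Pi.single ⟨0, le_of_max_le_right hd⟩ 1 with he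
    have he0 : e ≠ 0 := by simp [he]
    have hu : (Function.support (Pi.single e (1 : ℝ) : (Fin d → ℤ) → ℝ)).Finite :=
      (Set.finite_singleton e).subset Pi.support_single_subset
    refine ⟨Pi.single e 1, hu, by simp [he0.symm], by simp, ?_⟩
    simp only [sq_abs]
    refine (tsum_iterate_latticeDelta_sq_le hu k).trans (le_of_eq ?_)
    congr 1
    rw [tsum_eq_single e fun n hn => by simp [hn],
      tsum_eq_single (⟨e, he0⟩ : {m : Fin d → ℤ // m ≠ 0}) fun n hn => by
        have : n.1 ≠ e := fun h => hn (Subtype.ext h)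
        simp [this]]
    have hsum : ∑ j, (e j : ℝ) ^ 2 = 1 := by
      simp [he, Pi.single_apply]
    simp [hsum]
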